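/- Let ε : F(n,1) → {−1,1} be a function on the edges of the n-dimensional hypercube such that p(s,ε) = 1 for every square s. Then ε(θ) := Π_i ε(θ_i) takes the same value on every monotone path of edges θ of length n from (0,…,0) to (1,…,1). -/

import Mathlib

abbrev Vertex (n : ℕ) := Fin n → Bool
abbrev Face (n : ℕ) := Fin n → Option Bool

abbrev IsEdge {n : ℕ} (a : Face n) : Prop :=
  (Finset.univ.filter fun i => a i = none).card = 1

abbrev IsSq {n : ℕ} (s : Face n) : Prop :=
  (Finset.univ.filter fun i => s i = none).card = 2

/-- Endpoint of a face: replace every `*` (i.e. `none`) by the bit `b`. -/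
abbrev ep {n : ℕ} (b : Bool) (a : Face n) : Vertex n := fun i => (a i).getD b

/-- A path of edges of length `k` from `u` to `w`. -/
def IsPathFromTo (n k : ℕ) (θ : Fin k → Face n) (u w : Vertex n) : Prop :=
  (∀ i, IsEdge (θ i)) ∧
  (∀ (i : Fin k) (h : i.val + 1 < k), ep true (θ i) = ep false (θ ⟨i.val + 1, h⟩)) ∧
  (∀ h : 0 < k, ep false (θ ⟨0, h⟩) = u) ∧
  (∀ h : 0 < k, ep true (θ ⟨k - 1, Nat.sub_lt h one_pos⟩) = w) ∧
  (k = 0 → u = w)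

/-- Product of `ε` over the four boundary edges of the square `s`. -/
def pSq (n : ℕ) (s : Face n) (ε : Face n → ℤ) : ℤ :=
  ∏ a ∈ Finset.univ.filter (fun a : Face n => IsEdge a ∧ ∀ j, s j ≠ none → a j = s j), ε a

/-- The edge starting at `v` in direction `i` (the value of `v` at `i` is ignored). -/
def edgeAt {n : ℕ} (v : Vertex n) (i : Fin n) : Face n :=
  fun j => if j = i then none else some (v j)

/-- The square at `v` in directions `i` and `k`. -/
def squareAt {n : ℕ} (v : Vertex n) (i k : Fin n) : Face n :=
  fun j => if j = i ∨ j = k then none else some (v j)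

theorem isEdge_iff {n : ℕ} (a : Face n) : IsEdge a ↔ ∃ x, ∀ y, a y = none ↔ y = x := by
  simp [IsEdge, Finset.card_eq_one, Finset.ext_iff]

theorem isEdge_edgeAt {n : ℕ} (v : Vertex n) (i : Fin n) : IsEdge (edgeAt v i) :=
  (isEdge_iff _).2 ⟨i, fun y => by simp [edgeAt]⟩

theorem isSq_squareAt {n : ℕ} (v : Vertex n) {i k : Fin n} (hik : i ≠ k) :
    IsSq (squareAt v i k) :=
  Finset.card_eq_two.2 ⟨i, k, hik, by ext; simp [squareAt, or_iff_not_imp_left]⟩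

theorem IsEdge.exists_eq_edgeAt {n : ℕ} {a : Face n} (ha : IsEdge a) :
    ∃ i, ep false a i = false ∧ a = edgeAt (ep false a) i ∧
      ep true a = Function.update (ep false a) i true := by
  obtain ⟨x, hx⟩ := (isEdge_iff a).1 ha
  have key : ∀ y, y ≠ x → ∃ b, a y = some b := fun y hy =>
    Option.ne_none_iff_exists'.1 fun h => hy ((hx y).1 h)
  have hxx : a x = none := (hx x).2 rfl
  refine ⟨x, by simp [ep, hxx], ?_, ?_⟩
  · funext y
    by_cases hy : y = x
    · subst hy; simp [edgeAt, hxx]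
    · obtain ⟨b, hb⟩ := key y hy
      simp [edgeAt, ep, hy, hb]
  · funext y
    by_cases hy : y = x
    · subst hy; simp [ep, hxx]
    · obtain ⟨b, hb⟩ := key y hy
      simp [ep, hy, hb]

theorem filter_boundary_squareAt {n : ℕ} (v : Vertex n) {i k : Fin n} (hik : i ≠ k)
    (hi : v i = false) (hk : v k = false) :
    (Finset.univ.filter fun a : Face n =>
        IsEdge a ∧ ∀ j, squareAt v i k j ≠ none → a j = squareAt v i k j) =
      {edgeAt v i, edgeAt (Function.update v k true) i,
        edgeAt v k, edgeAt (Function.update v i true) k} := by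
  ext a
  simp only [Finset.mem_filter, Finset.mem_univ, true_and, Finset.mem_insert,
    Finset.mem_singleton]
  constructor
  · rintro ⟨ha, hs⟩
    obtain ⟨x, hx⟩ := (isEdge_iff a).1 ha
    have hs' : ∀ j, j ≠ i → j ≠ k → a j = some (v j) := fun j h1 h2 => by
      simpa [squareAt, h1, h2] using hs j
    have hcase : x = i ∨ x = k := by
      by_contra! hc
      simpa [(hx x).2 rfl] using hs' x hc.1 hc.2
    rcases hcase with rfl | rfl
    · obtain ⟨b, hb⟩ := Option.ne_none_iff_exists'.1 fun h => hik ((hx k).1 h).symm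
      have hxx := (hx x).2 rfl
      cases b
      · left; funext j; simp only [edgeAt]; grind
      · right; left; funext j; simp only [edgeAt, Function.update_apply]; grind
    · obtain ⟨b, hb⟩ := Option.ne_none_iff_exists'.1 fun h => hik ((hx i).1 h)
      have hxx := (hx x).2 rfl
      cases b
      · right; right; left; funext j; simp only [edgeAt]; grind
      · right; right; right; funext j; simp only [edgeAt, Function.update_apply]; grind
  · rintro (rfl | rfl | rfl | rfl) <;> refine ⟨isEdge_edgeAt _ _, fun j hj => ?_⟩ <;>
      simp only [edgeAt, squareAt, Function.update_apply] at hj ⊢ <;> grind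

theorem pSq_squareAt {n : ℕ} (ε : Face n → ℤ) (v : Vertex n) {i k : Fin n} (hik : i ≠ k)
    (hi : v i = false) (hk : v k = false) :
    pSq n (squareAt v i k) ε =
      ε (edgeAt v i) * (ε (edgeAt (Function.update v k true) i) *
        (ε (edgeAt v k) * ε (edgeAt (Function.update v i true) k))) := by
  have hne : ∀ w w' : Vertex n, edgeAt w i ≠ edgeAt w' k := fun w w' h => by
    simpa [edgeAt, hik] using congrFun h i
  have hne₁ : edgeAt v i ≠ edgeAt (Function.update v k true) i := fun h => by
    simpa [edgeAt, hik.symm, hk] using congrFun h k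
  have hne₂ : edgeAt v k ≠ edgeAt (Function.update v i true) k := fun h => by
    simpa [edgeAt, hik, hi] using congrFun h i
  rw [pSq, filter_boundary_squareAt v hik hi hk, Finset.prod_insert, Finset.prod_insert,
    Finset.prod_insert, Finset.prod_singleton] <;> simp [hne, hne₁, hne₂]

/-- The two ways around a square have the same `ε`-product. -/
theorem mul_edgeAt_comm {n : ℕ} {ε : Face n → ℤ}
    (hε : ∀ a : Face n, IsEdge a → ε a = 1 ∨ ε a = -1)
    (h : ∀ s : Face n, IsSq s → pSq n s ε = 1)
    (v : Vertex n) {i k : Fin n} (hik : i ≠ k) (hi : v i = false) (hk : v k = false) :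
    ε (edgeAt v k) * ε (edgeAt (Function.update v k true) i) =
      ε (edgeAt v i) * ε (edgeAt (Function.update v i true) k) := by
  have hp := h _ (isSq_squareAt v hik)
  rw [pSq_squareAt ε v hik hi hk] at hp
  rcases hε _ (isEdge_edgeAt v i) with h₁ | h₁ <;>
  rcases hε _ (isEdge_edgeAt v k) with h₂ | h₂ <;>
  rcases hε _ (isEdge_edgeAt (Function.update v k true) i) with h₃ | h₃ <;>
  rcases hε _ (isEdge_edgeAt (Function.update v i true) k) with h₄ | h₄ <;>
  simp_all

/-- `PathProd ε v p`: some monotone path of edges from the bottom vertex to `v` has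
`ε`-product `p`. -/
inductive PathProd {n : ℕ} (ε : Face n → ℤ) : Vertex n → ℤ → Prop
  | bot : PathProd ε (fun _ => false) 1
  | step {v : Vertex n} {p : ℤ} (i : Fin n) (hi : v i = false) (hp : PathProd ε v p) :
      PathProd ε (Function.update v i true) (p * ε (edgeAt v i))

theorem lt_update_true {n : ℕ} {v : Vertex n} {i : Fin n} (hi : v i = false) :
    v < Function.update v i true :=
  lt_update_self_iff.2 (by simp [hi])

theorem exists_pathProd {n : ℕ} (ε : Face n → ℤ) (v : Vertex n) : ∃ p, PathProd ε v p := by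
  induction v using WellFoundedLT.induction with
  | ind v ih =>
    by_cases hv : ∃ i, v i = true
    · obtain ⟨i, hi⟩ := hv
      have hv' : Function.update (Function.update v i false) i true = v := by
        rw [Function.update_idem, ← hi, Function.update_eq_self]
      have hf : Function.update v i false i = false := Function.update_self ..
      obtain ⟨p, hp⟩ := ih (Function.update v i false) ((lt_update_true hf).trans_eq hv')
      exact ⟨_, hv' ▸ hp.step i hf⟩
    · obtain rfl : v = fun _ => false := funext fun i => by
        simpa using not_exists.1 hv i
      exact ⟨1, .bot⟩

theorem PathProd.unique {n : ℕ} {ε : Face n → ℤ}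
    (hε : ∀ a : Face n, IsEdge a → ε a = 1 ∨ ε a = -1)
    (h : ∀ s : Face n, IsSq s → pSq n s ε = 1)
    {w : Vertex n} {p q : ℤ} (hp : PathProd ε w p) (hq : PathProd ε w q) : p = q := by
  induction w using WellFoundedLT.induction generalizing p q with
  | ind w ih =>
    generalize hw : w = w' at hq
    cases hp with
    | bot =>
      cases hq with
      | bot => rfl
      | step i hi hq => simpa using congrFun hw i
    | @step v p i hi hp =>
      cases hq with
      | bot => simpa using congrFun hw i
      | @step v' q k hk hq =>
        by_cases hik : i = k
        · subst hik
          obtain rfl : v = v' := funext fun j => by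
            have := congrFun hw j
            simp only [Function.update_apply] at this
            grind
          rw [ih v (lt_update_true hi) hp hq]
        · set u := Function.update v k false with hu
          have hui : u i = false := by simp [hu, hik, hi]
          have huk : u k = false := by simp [hu]
          have hv : v = Function.update u k true := funext fun j => by
            have := congrFun hw j
            simp only [hu, Function.update_apply] at this ⊢
            grind
          have hv' : v' = Function.update u i true := funext fun j => by
            have := congrFun hw j
            simp only [hu, Function.update_apply] at this ⊢
            grind
          obtain ⟨r, hr⟩ := exists_pathProd ε u
          rw [ih v (lt_update_true hi) hp (hv ▸ hr.step k huk),
            ih v' (hw ▸ lt_update_true hk) hq (hv' ▸ hr.step i hui), hv, hv', mul_assoc, mul_assoc,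
            mul_edgeAt_comm hε h u hik hui huk]

theorem PathProd.step_edge {n : ℕ} {ε : Face n → ℤ} {a : Face n} (ha : IsEdge a) {p : ℤ}
    (hp : PathProd ε (ep false a) p) : PathProd ε (ep true a) (p * ε a) := by
  obtain ⟨i, hi, hai, hup⟩ := ha.exists_eq_edgeAt
  have := hp.step i hi
  rwa [← hai, ← hup] at this

theorem IsPathFromTo.pathProd {n k : ℕ} (ε : Face n → ℤ) {θ : Fin k → Face n} {w : Vertex n}
    (hθ : IsPathFromTo n k θ (fun _ => false) w) : PathProd ε w (∏ i, ε (θ i)) := by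
  obtain ⟨hedge, hchain, hstart, hend, hzero⟩ := hθ
  have key : ∀ m (hm : m < k),
      PathProd ε (ep true (θ ⟨m, hm⟩)) (∏ i : Fin (m + 1), ε (θ (Fin.castLE hm i))) := by
    intro m
    induction m with
    | zero =>
      intro hm
      rw [Fin.prod_univ_castSucc]
      refine PathProd.step_edge (hedge _) ?_
      rw [hstart hm]
      exact .bot
    | succ m ih =>
      intro hm
      rw [Fin.prod_univ_castSucc]
      refine PathProd.step_edge (hedge _) ?_
      rw [← hchain ⟨m, by lia⟩ hm]
      exact ih (by lia)
  cases k with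
  | zero =>
    rw [← hzero rfl]
    exact .bot
  | succ k =>
    rw [← hend k.succ_pos]
    exact key k k.lt_succ_self

/-- If `ε` is a `{−1,1}`-valued function on the edges with `p(s,ε) = 1` for every
square, then `ε(θ) = ∏ᵢ ε(θᵢ)` takes the same value on every monotone path of
edges of length `n` from `(0,…,0)` to `(1,…,1)`. -/
theorem eps_path_independent (n : ℕ) (ε : Face n → ℤ)
    (hε : ∀ a : Face n, IsEdge a → ε a = 1 ∨ ε a = -1)
    (h : ∀ s : Face n, IsSq s → pSq n s ε = 1)
    (θ ζ : Fin n → Face n)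
    (hθ : IsPathFromTo n n θ (fun _ => false) (fun _ => true))
    (hζ : IsPathFromTo n n ζ (fun _ => false) (fun _ => true)) :
    ∏ i, ε (θ i) = ∏ i, ε (ζ i) := by
  exact (hθ.pathProd ε).unique hε h (hζ.pathProd ε)
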